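/- Let l ≥ 0 and k ≥ 2 be integers and let H = ℤ/4ℤ ⋉ (ℤ^l ⊕ ℤ/2^k ℤ). Then in the quotient group H/Z(H) of H by its center, the cosets of (1, 0) and of (0, 2^{k-2}) are two distinct elements of order 2; in particular H/Z(H) has at least two involutions. -/

import Mathlib

/-- Negation as a multiplicative automorphism of `Multiplicative A`. -/
def negAut (A : Type*) [AddCommGroup A] : MulAut (Multiplicative A) :=
  AddEquiv.toMultiplicative (AddEquiv.neg A)

/-- The action of `ZMod 2` on `Multiplicative A` where `1` acts by negation. -/
def actZ2 (A : Type*) [AddCommGroup A] :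
    Multiplicative (ZMod 2) →* MulAut (Multiplicative A) where
  toFun z := if Multiplicative.toAdd z = 0 then 1 else negAut A
  map_one' := by simp
  map_mul' := fun x y => by
    have h : ∀ z : ZMod 2, z = 0 ∨ z = 1 := by decide
    have h2 : negAut A * negAut A = 1 := by
      ext a
      simp [negAut]
    rcases h (Multiplicative.toAdd x) with hx | hx <;>
      rcases h (Multiplicative.toAdd y) with hy | hy <;>
      simp [toAdd_mul, hx, hy, h2, show (1+1 : ZMod 2) = 0 from by decide]

/-- The action of `ℤ/4` on `Multiplicative A` given by `x • a = (-1)^x • a`;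
it factors through `ZMod 4 → ZMod 2`. -/
def negAct (A : Type*) [AddCommGroup A] :
    Multiplicative (ZMod 4) →* MulAut (Multiplicative A) :=
  (actZ2 A).comp (AddMonoidHom.toMultiplicative
    ((ZMod.castHom (by norm_num : (2:ℕ) ∣ 4) (ZMod 2)).toAddMonoidHom))

/-- The semidirect product `ℤ/4 ⋉ A`, with `x : ℤ/4` acting by `a ↦ (-1)^x a`. -/
abbrev Zfour_sd (A : Type*) [AddCommGroup A] :=
  Multiplicative A ⋊[negAct A] Multiplicative (ZMod 4)

theorem negAct_even {A : Type*} [AddCommGroup A] (x : ZMod 4) (hx : x = 0 ∨ x = 2) :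
    negAct A (Multiplicative.ofAdd x) = 1 := by
  rcases hx with h | h <;> subst h <;>
  · ext a
    simp [negAct, actZ2, show (ZMod.cast (0 : ZMod 4) : ZMod 2) = 0 from by decide,
      show (ZMod.cast (2 : ZMod 4) : ZMod 2) = 0 from by decide]

theorem negAct_apply_or {A : Type*} [AddCommGroup A] (x : Multiplicative (ZMod 4))
    (a : Multiplicative A) : negAct A x a = a ∨ negAct A x a = a⁻¹ := by
  by_cases h : (ZMod.cast (Multiplicative.toAdd x) : ZMod 2) = 0
  · left; simp [negAct, actZ2, h]
  · right
    simp only [negAct, actZ2, MonoidHom.comp_apply, MonoidHom.coe_mk, OneHom.coe_mk]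
    rw [if_neg]
    · rfl
    · simpa using h

theorem central_mem {A : Type*} [AddCommGroup A] (a0 : A) (ha : a0 + a0 = 0) (x : ZMod 4)
    (hx : x = 0 ∨ x = 2) :
    (⟨Multiplicative.ofAdd a0, Multiplicative.ofAdd x⟩ : Zfour_sd A) ∈
      Subgroup.center (Zfour_sd A) := by
  rw [Subgroup.mem_center_iff]
  rintro ⟨b, y⟩
  have hinv : (Multiplicative.ofAdd a0)⁻¹ = Multiplicative.ofAdd a0 := by
    rw [← ofAdd_neg, neg_eq_of_add_eq_zero_left ha]
  ext
  · show b * negAct A y (Multiplicative.ofAdd a0)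
        = Multiplicative.ofAdd a0 * negAct A (Multiplicative.ofAdd x) b
    rw [negAct_even x hx]
    rcases negAct_apply_or y (Multiplicative.ofAdd a0) with h | h <;>
      rw [h] <;> simp [hinv, mul_comm]
  · show y * Multiplicative.ofAdd x = Multiplicative.ofAdd x * y
    exact mul_comm _ _

theorem zpowers_normal_of_central {G : Type*} [Group G] {g : G}
    (hg : g ∈ Subgroup.center G) : (Subgroup.zpowers g).Normal := by
  constructor
  intro x hx h
  rcases Subgroup.mem_zpowers_iff.mp hx with ⟨k, rfl⟩
  have hc := Subgroup.mem_center_iff.mp ((Subgroup.center G).zpow_mem hg k) h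
  rw [hc, mul_assoc, mul_inv_cancel, mul_one]
  exact Subgroup.mem_zpowers_iff.mpr ⟨k, rfl⟩

theorem doubling (k : ℕ) : (2^(k-1) : ZMod (2^k)) + 2^(k-1) = 0 := by
  rcases Nat.eq_zero_or_pos k with hk | hk
  · subst hk; decide
  · rw [← two_mul, ← pow_succ', Nat.sub_add_cancel hk]
    have h := ZMod.natCast_self (2^k)
    push_cast at h
    exact h

/-- The abelian group `ℤ^l ⊕ ℤ/2^k`. -/
abbrev Agrp (l k : ℕ) : Type := (Fin l → ℤ) × ZMod (2^k)

/-- The semidirect product `H = ℤ/4 ⋉ (ℤ^l ⊕ ℤ/2^k)`. -/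
abbrev Hgrp (l k : ℕ) := Zfour_sd (Agrp l k)

theorem doublingA (l k : ℕ) :
    (((0 : Fin l → ℤ), (2^(k-1) : ZMod (2^k))) : Agrp l k)
      + ((0 : Fin l → ℤ), (2^(k-1) : ZMod (2^k))) = 0 := by
  rw [Prod.mk_add_mk, add_zero, doubling k]
  rfl

/-- The element `(2, 2^{k-1})` of `H = ℤ/4 ⋉ (ℤ^l ⊕ ℤ/2^k)`. -/
def relHK (l k : ℕ) : Hgrp l k :=
  ⟨Multiplicative.ofAdd (((0 : Fin l → ℤ), (2^(k-1) : ZMod (2^k))) : Agrp l k),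
   Multiplicative.ofAdd (2 : ZMod 4)⟩

theorem relHK_central (l k : ℕ) : relHK l k ∈ Subgroup.center (Hgrp l k) :=
  central_mem _ (doublingA l k) _ (Or.inr rfl)

instance relHK_zpowers_normal (l k : ℕ) : (Subgroup.zpowers (relHK l k)).Normal :=
  zpowers_normal_of_central (relHK_central l k)

theorem negAct_one_apply {A : Type*} [AddCommGroup A] (a : Multiplicative A) :
    negAct A (Multiplicative.ofAdd 1) a = a⁻¹ := by
  simp only [negAct, actZ2, MonoidHom.comp_apply, MonoidHom.coe_mk, OneHom.coe_mk]
  rw [if_neg]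
  · rfl
  · simp

theorem negAct_right_apply_of_mem_center {A : Type*} [AddCommGroup A] {g : Zfour_sd A}
    (hg : g ∈ Subgroup.center (Zfour_sd A)) (a : Multiplicative A) :
    negAct A g.right a = a := by
  have h := congrArg SemidirectProduct.left
    (Subgroup.mem_center_iff.mp hg (SemidirectProduct.inl a))
  simpa [mul_comm a] using h.symm

theorem left_inv_of_mem_center {A : Type*} [AddCommGroup A] {g : Zfour_sd A}
    (hg : g ∈ Subgroup.center (Zfour_sd A)) : g.left⁻¹ = g.left := by
  have h := congrArg SemidirectProduct.left
    (Subgroup.mem_center_iff.mp hg (SemidirectProduct.inr (Multiplicative.ofAdd 1)))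
  simpa [negAct_one_apply] using h

theorem two_pow_pred_ne_zero {k : ℕ} (hk : 0 < k) : (2 ^ (k - 1) : ZMod (2 ^ k)) ≠ 0 := by
  intro h
  have h' : ((2 ^ (k - 1) : ℕ) : ZMod (2 ^ k)) = 0 := by exact_mod_cast h
  rw [ZMod.natCast_eq_zero_iff, Nat.pow_dvd_pow_iff_le_right (by norm_num)] at h'
  omega

theorem neg_two_pow_ne {k : ℕ} (hk : 2 ≤ k) :
    -(2 ^ (k - 2) : ZMod (2 ^ k)) ≠ 2 ^ (k - 2) := by
  intro h
  apply two_pow_pred_ne_zero (k := k) (by omega)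
  rw [show k - 1 = (k - 2) + 1 by omega, pow_succ, mul_two]
  nth_rewrite 1 [← h]
  exact neg_add_cancel _

theorem orderOf_mk_eq_two {G : Type*} [Group G] {N : Subgroup G} [N.Normal] {g : G}
    (hsq : g * g ∈ N) (hg : g ∉ N) : orderOf (g : G ⧸ N) = 2 := by
  refine orderOf_eq_prime ?_ ?_
  · rw [pow_two, ← QuotientGroup.mk_mul]
    exact (QuotientGroup.eq_one_iff _).mpr hsq
  · exact fun h => hg ((QuotientGroup.eq_one_iff _).mp h)

/-- For `l ≥ 0`, `k ≥ 2` and `H = ℤ/4 ⋉ (ℤ^l ⊕ ℤ/2^k)`, the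
cosets of `(1,0)` and of `(0,2^{k-2})` in `H/Z(H)` are two distinct elements of
order `2`. -/
theorem quotient_by_center_two_involutions (l k : ℕ) (hk : 2 ≤ k) :
    let q : Hgrp l k → Hgrp l k ⧸ Subgroup.center (Hgrp l k) := QuotientGroup.mk
    let h₁ : Hgrp l k :=
      ⟨Multiplicative.ofAdd (((0 : Fin l → ℤ), (0 : ZMod (2^k))) : Agrp l k),
        Multiplicative.ofAdd (1 : ZMod 4)⟩
    let h₂ : Hgrp l k :=
      ⟨Multiplicative.ofAdd (((0 : Fin l → ℤ), (2^(k-2) : ZMod (2^k))) : Agrp l k),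
        Multiplicative.ofAdd (0 : ZMod 4)⟩
    q h₁ ≠ q h₂ ∧ orderOf (q h₁) = 2 ∧ orderOf (q h₂) = 2 := by
  intro q h₁ h₂
  set e : Multiplicative (Agrp l k) := Multiplicative.ofAdd (0, 2 ^ (k - 2)) with he
  have he_inv : e⁻¹ ≠ e := fun h =>
    neg_two_pow_ne hk (congrArg (fun a : Multiplicative (Agrp l k) => a.toAdd.2) h)
  have hact (a : Multiplicative (Agrp l k)) : negAct _ h₁.right a = a⁻¹ := negAct_one_apply a
  have hact₂ (a : Multiplicative (Agrp l k)) : negAct _ h₂.right a = a := by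
    rw [show h₂.right = 1 from rfl, map_one, MulAut.one_apply]
  have hh₁ : h₁ ∉ Subgroup.center (Hgrp l k) := fun h =>
    he_inv ((hact e).symm.trans (negAct_right_apply_of_mem_center h e))
  have hh₂ : h₂ ∉ Subgroup.center (Hgrp l k) := fun h => he_inv (left_inv_of_mem_center h)
  refine ⟨fun h => ?_, orderOf_mk_eq_two ?_ hh₁, orderOf_mk_eq_two ?_ hh₂⟩
  · have hc := negAct_right_apply_of_mem_center (QuotientGroup.eq.mp h.symm) e
    rw [SemidirectProduct.mul_right, SemidirectProduct.inv_right, map_mul, MulAut.mul_apply,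
      hact, show h₂.right = 1 from rfl, inv_one, map_one, MulAut.one_apply] at hc
    exact he_inv hc
  · have hsq : h₁ * h₁ = ⟨Multiplicative.ofAdd 0, Multiplicative.ofAdd 2⟩ := by
      ext1
      · rw [SemidirectProduct.mul_left, hact, mul_inv_cancel]
        rfl
      · rfl
    rw [hsq]
    exact central_mem 0 (add_zero 0) 2 (Or.inr rfl)
  · have hsq : h₂ * h₂ =
        ⟨Multiplicative.ofAdd ((0 : Fin l → ℤ), (2 ^ (k - 1) : ZMod (2 ^ k))),
          Multiplicative.ofAdd 0⟩ := by
      ext1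
      · rw [SemidirectProduct.mul_left, hact₂]
        refine congrArg Multiplicative.ofAdd (Prod.ext (add_zero 0) ?_)
        change (2 ^ (k - 2) : ZMod (2 ^ k)) + 2 ^ (k - 2) = 2 ^ (k - 1)
        rw [show k - 1 = (k - 2) + 1 by omega, pow_succ, mul_two]
      · rfl
    rw [hsq]
    exact central_mem _ (doublingA l k) 0 (Or.inl rfl)
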